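/- Suppose the external field F₀ is constant and (a,φ) is an irreducible degree-d GL solution. Then the curvature satisfies the pointwise bound |F(a)(x)| ≤ max{α, α/(2β)} − |φ(x)|²/2 for all x ∈ ℝ². -/

import Mathlib

open MeasureTheory Complex

noncomputable section

/-- Partial derivative in the first coordinate direction. -/
def pd1 {E : Type*} [NormedAddCommGroup E] [NormedSpace ℝ E]
    (f : ℝ × ℝ → E) (x : ℝ × ℝ) : E := fderiv ℝ f x (1, 0)

/-- Partial derivative in the second coordinate direction. -/
def pd2 {E : Type*} [NormedAddCommGroup E] [NormedSpace ℝ E]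
    (f : ℝ × ℝ → E) (x : ℝ × ℝ) : E := fderiv ℝ f x (0, 1)

/-- Covariant derivative `D₁φ = ∂₁φ + i a₁ φ`. -/
def D1 (a1 : ℝ × ℝ → ℝ) (φ : ℝ × ℝ → ℂ) : ℝ × ℝ → ℂ :=
  fun x => pd1 φ x + Complex.I * (a1 x : ℂ) * φ x

/-- Covariant derivative `D₂φ = ∂₂φ + i a₂ φ`. -/
def D2 (a2 : ℝ × ℝ → ℝ) (φ : ℝ × ℝ → ℂ) : ℝ × ℝ → ℂ :=
  fun x => pd2 φ x + Complex.I * (a2 x : ℂ) * φ x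

/-- Curvature `F(a) = ∂₁a₂ − ∂₂a₁`. -/
def curv (a1 a2 : ℝ × ℝ → ℝ) : ℝ × ℝ → ℝ :=
  fun x => pd1 a2 x - pd2 a1 x

/-- The fundamental domain `[0,1]²`. -/
def unitSquare : Set (ℝ × ℝ) := Set.Icc (0, 0) (1, 1)

/-- A degree-`d` field pair on the torus: smooth quasi-periodic `(a, φ)`. -/
structure FieldPair (d : ℤ) where
  a1 : ℝ × ℝ → ℝ
  a2 : ℝ × ℝ → ℝ
  φ : ℝ × ℝ → ℂ
  smooth_a1 : ContDiff ℝ (⊤ : ℕ∞) a1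
  smooth_a2 : ContDiff ℝ (⊤ : ℕ∞) a2
  smooth_φ : ContDiff ℝ (⊤ : ℕ∞) φ
  per1_a1 : ∀ x : ℝ × ℝ, a1 (x.1 + 1, x.2) = a1 x
  per1_a2 : ∀ x : ℝ × ℝ, a2 (x.1 + 1, x.2) = a2 x
  per1_φ : ∀ x : ℝ × ℝ, φ (x.1 + 1, x.2) = φ x
  per2_a2 : ∀ x : ℝ × ℝ, a2 (x.1, x.2 + 1) = a2 x
  per2_a1 : ∀ x : ℝ × ℝ, a1 (x.1, x.2 + 1) = a1 x - 2 * Real.pi * d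
  per2_φ : ∀ x : ℝ × ℝ, φ (x.1, x.2 + 1) =
      Complex.exp (2 * Real.pi * Complex.I * (d : ℂ) * (x.1 : ℂ)) * φ x

/-- The smooth ℤ²-periodic external field with `∫_{[0,1]²} F₀ = 2πd`. -/
def ExternalField (d : ℤ) (F₀ : ℝ × ℝ → ℝ) : Prop :=
  ContDiff ℝ (⊤ : ℕ∞) F₀ ∧ (∀ x : ℝ × ℝ, F₀ (x.1 + 1, x.2) = F₀ x) ∧
    (∀ x : ℝ × ℝ, F₀ (x.1, x.2 + 1) = F₀ x) ∧
    (∫ x in unitSquare, F₀ x) = 2 * Real.pi * d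

/-- The Ginzburg–Landau free energy. -/
def energy (α β : ℝ) (F₀ : ℝ × ℝ → ℝ) {d : ℤ} (P : FieldPair d) : ℝ :=
  (1 / 2) * ∫ x in unitSquare,
    ((curv P.a1 P.a2 x - F₀ x) ^ 2 + ‖D1 P.a1 P.φ x‖ ^ 2 + ‖D2 P.a2 P.φ x‖ ^ 2
      - α * ‖P.φ x‖ ^ 2 + (β / 2) * ‖P.φ x‖ ^ 4)

/-- The Ginzburg–Landau equations. -/
def IsGLSolution (α β : ℝ) (F₀ : ℝ × ℝ → ℝ) {d : ℤ} (P : FieldPair d) : Prop :=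
  (∀ x : ℝ × ℝ,
      pd2 (fun y => curv P.a1 P.a2 y - F₀ y) x
        + ((starRingEnd ℂ) (P.φ x) * D1 P.a1 P.φ x).im = 0) ∧
  (∀ x : ℝ × ℝ,
      -pd1 (fun y => curv P.a1 P.a2 y - F₀ y) x
        + ((starRingEnd ℂ) (P.φ x) * D2 P.a2 P.φ x).im = 0) ∧
  (∀ x : ℝ × ℝ,
      -(D1 P.a1 (D1 P.a1 P.φ) x + D2 P.a2 (D2 P.a2 P.φ) x)
        = (α : ℂ) * P.φ x - (β : ℂ) * (‖P.φ x‖ : ℂ) ^ 2 * P.φ x)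

/-- The set of energies of all degree-`d` field pairs. -/
def energySet (α β : ℝ) (F₀ : ℝ × ℝ → ℝ) (d : ℤ) : Set ℝ :=
  { t : ℝ | ∃ P : FieldPair d, t = energy α β F₀ P }

/-- `λ₁`, the lowest eigenvalue of the covariant Laplacian among connections
with curvature `F₀`. -/
def lambda1 (d : ℤ) (F₀ : ℝ × ℝ → ℝ) : ℝ :=
  sInf { t : ℝ | ∃ P : FieldPair d,
    (∀ x : ℝ × ℝ, curv P.a1 P.a2 x = F₀ x) ∧
    (∫ x in unitSquare, ‖P.φ x‖ ^ 2) = 1 ∧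
    t = ∫ x in unitSquare, (‖D1 P.a1 P.φ x‖ ^ 2 + ‖D2 P.a2 P.φ x‖ ^ 2) }

section Calculus

variable {E : Type*} [NormedAddCommGroup E] [NormedSpace ℝ E]

lemma contDiff_pd1 {f : ℝ × ℝ → E} (hf : ContDiff ℝ (⊤ : ℕ∞) f) :
    ContDiff ℝ (⊤ : ℕ∞) (pd1 f) :=
  (hf.fderiv_right (m := (⊤ : ℕ∞)) (by simp)).clm_apply contDiff_const

lemma contDiff_pd2 {f : ℝ × ℝ → E} (hf : ContDiff ℝ (⊤ : ℕ∞) f) :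
    ContDiff ℝ (⊤ : ℕ∞) (pd2 f) :=
  (hf.fderiv_right (m := (⊤ : ℕ∞)) (by simp)).clm_apply contDiff_const

lemma ContDiff.differentiableAt_of_top {f : ℝ × ℝ → E} (hf : ContDiff ℝ (⊤ : ℕ∞) f) (x : ℝ × ℝ) :
    DifferentiableAt ℝ f x :=
  hf.differentiable (by simp) x

lemma pd1_pd2_comm {f : ℝ × ℝ → E} (hf : ContDiff ℝ (⊤ : ℕ∞) f) (x : ℝ × ℝ) :
    pd1 (pd2 f) x = pd2 (pd1 f) x := by
  have hd : DifferentiableAt ℝ (fderiv ℝ f) x :=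
    (hf.fderiv_right (m := (⊤ : ℕ∞)) (by simp)).differentiable (by simp) x
  have hs : IsSymmSndFDerivAt ℝ f x :=
    hf.contDiffAt.isSymmSndFDerivAt (by
      rw [minSmoothness_of_isRCLikeNormedField]; exact WithTop.coe_le_coe.2 le_top)
  have key (u v : ℝ × ℝ) :
      fderiv ℝ (fun y => fderiv ℝ f y u) x v = fderiv ℝ (fderiv ℝ f) x v u := by
    rw [fderiv_clm_apply hd (differentiableAt_const u)]
    simp
  exact (key _ _).trans ((hs _ _).trans (key _ _).symm)

lemma fderiv_comp_add (f : ℝ × ℝ → E) (c x : ℝ × ℝ) :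
    fderiv ℝ (fun y => f (y + c)) x = fderiv ℝ f (x + c) :=
  fderiv_comp_add_right c

end Calculus

section MaximumPrinciple

lemma fderiv_eq_zero_of_pd {f : ℝ × ℝ → ℝ} {x : ℝ × ℝ} (h1 : pd1 f x = 0) (h2 : pd2 f x = 0) :
    fderiv ℝ f x = 0 := by
  ext
  · simpa [pd1] using h1
  · simpa [pd2] using h2

lemma hasDerivAt_posPart_sq (t : ℝ) :
    HasDerivAt (fun s : ℝ => max s 0 ^ 2) (2 * max t 0) t := by
  rcases lt_trichotomy t 0 with ht | rfl | ht
  · rw [max_eq_right ht.le, mul_zero]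
    refine (hasDerivAt_const t (0 : ℝ)).congr_of_eventuallyEq ?_
    filter_upwards [gt_mem_nhds ht] with s hs
    simp [max_eq_right (le_of_lt hs)]
  · rw [hasDerivAt_iff_isLittleO_nhds_zero]
    simp only [zero_add, max_self, mul_zero, smul_zero, sub_zero, ne_eq, OfNat.ofNat_ne_zero,
      not_false_eq_true, zero_pow]
    have h : (fun s : ℝ => max s 0 ^ 2) =O[nhds 0] fun s : ℝ => s ^ 2 := by
      refine Asymptotics.isBigO_of_le _ fun s => ?_
      rcases le_total s 0 with hs | hs <;> simp [hs, sq_nonneg]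
    refine h.trans_isLittleO ?_
    simpa using Asymptotics.isLittleO_pow_pow (𝕜 := ℝ) (m := 1) (n := 2) one_lt_two
  · rw [max_eq_left ht.le]
    have : HasDerivAt (fun s : ℝ => s ^ 2) (2 * t) t := by simpa using hasDerivAt_pow 2 t
    refine this.congr_of_eventuallyEq ?_
    filter_upwards [lt_mem_nhds ht] with s hs
    simp [max_eq_left (le_of_lt hs)]

/-- A nonnegative continuous function with vanishing iterated integral over a unit square vanishes
at the corner of the square. -/
lemma eq_zero_of_iterated_integral_eq_zero {g : ℝ × ℝ → ℝ} (hg : Continuous g)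
    (hg0 : ∀ x, 0 ≤ g x) (a b : ℝ)
    (h : ∫ s in a..a + 1, ∫ t in b..b + 1, g (s, t) = 0) : g (a, b) = 0 := by
  by_contra hne
  have hpos : 0 < g (a, b) := lt_of_le_of_ne (hg0 _) (Ne.symm hne)
  have hinner : 0 < ∫ t in b..b + 1, g (a, t) :=
    intervalIntegral.integral_pos (by linarith)
      (hg.comp (Continuous.prodMk_right a)).continuousOn (fun t _ => hg0 _)
      ⟨b, by simp, hpos⟩
  have hcont : Continuous fun s => ∫ t in b..b + 1, g (s, t) :=
    intervalIntegral.continuous_parametric_intervalIntegral_of_continuous'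
      (f := fun s t => g (s, t)) (by simpa [Function.uncurry_def] using hg) b (b + 1)
  have := intervalIntegral.integral_pos (a := a) (b := a + 1) (by linarith) hcont.continuousOn
    (fun s _ => intervalIntegral.integral_nonneg (by linarith) fun t _ => hg0 _)
    ⟨a, by simp, hinner⟩
  exact this.ne' h

/-- Strong maximum principle on the flat torus: a periodic function `v` with `Δv ≥ p v`, where
`p ≥ 0` is not identically zero, is nonpositive. -/
lemma nonpos_of_mul_le_laplacian {v p : ℝ × ℝ → ℝ} (hv : ContDiff ℝ (⊤ : ℕ∞) v)
    (hper1 : ∀ x : ℝ × ℝ, v (x + (1, 0)) = v x) (hper2 : ∀ x : ℝ × ℝ, v (x + (0, 1)) = v x)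
    (hp : ∀ x, 0 ≤ p x) (hp0 : ∃ x, p x ≠ 0)
    (hΔ : ∀ x, p x * v x ≤ pd1 (pd1 v) x + pd2 (pd2 v) x) (x : ℝ × ℝ) : v x ≤ 0 := by
  have hw (y : ℝ × ℝ) : HasFDerivAt (fun z => max (v z) 0 ^ 2)
      ((2 * max (v y) 0) • fderiv ℝ v y) y :=
    (hasDerivAt_posPart_sq (v y)).comp_hasFDerivAt y (hv.differentiableAt_of_top y).hasFDerivAt
  have hX1 (y : ℝ × ℝ) := (hw y).mul ((contDiff_pd1 hv).differentiableAt_of_top y).hasFDerivAt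
  have hX2 (y : ℝ × ℝ) := (hw y).mul ((contDiff_pd2 hv).differentiableAt_of_top y).hasFDerivAt
  have c1 := (contDiff_pd1 hv).continuous
  have c2 := (contDiff_pd2 hv).continuous
  have c11 := (contDiff_pd1 (contDiff_pd1 hv)).continuous
  have c22 := (contDiff_pd2 (contDiff_pd2 hv)).continuous
  have c0 := hv.continuous
  set g : ℝ × ℝ → ℝ := fun y => max (v y) 0 ^ 2 * (pd1 (pd1 v) y + pd2 (pd2 v) y)
    + 2 * max (v y) 0 * (pd1 v y ^ 2 + pd2 v y ^ 2) with hg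
  have hgc : Continuous g := by fun_prop
  have hle (y : ℝ × ℝ) : max (v y) 0 ^ 2 * (p y * v y) ≤
      g y - 2 * max (v y) 0 * (pd1 v y ^ 2 + pd2 v y ^ 2) := by
    have := mul_le_mul_of_nonneg_left (hΔ y) (sq_nonneg (max (v y) 0))
    simp only [hg]; linarith
  have hnn (y : ℝ × ℝ) : 0 ≤ max (v y) 0 ^ 2 * (p y * v y) := by
    rcases le_total (v y) 0 with h | h
    · simp [h]
    · exact mul_nonneg (sq_nonneg _) (mul_nonneg (hp y) h)
  have hnn' (y : ℝ × ℝ) : 0 ≤ 2 * max (v y) 0 * (pd1 v y ^ 2 + pd2 v y ^ 2) := by positivity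
  have hp11 (y : ℝ × ℝ) : pd1 v (y + (1, 0)) = pd1 v y := by
    simp only [pd1, ← fderiv_comp_add, hper1]
  have hp22 (y : ℝ × ℝ) : pd2 v (y + (0, 1)) = pd2 v y := by
    simp only [pd2, ← fderiv_comp_add, hper2]
  have hg0 (y : ℝ × ℝ) : g y = 0 := by
    refine eq_zero_of_iterated_integral_eq_zero hgc
      (fun y => by linarith [hle y, hnn y, hnn' y]) y.1 y.2 ?_
    have hdiv := integral2_divergence_prod_of_hasFDerivAt
      (fun z => max (v z) 0 ^ 2 * pd1 v z) (fun z => max (v z) 0 ^ 2 * pd2 v z) _ _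
      y.1 y.2 (y.1 + 1) (y.2 + 1)
      (by fun_prop) (by fun_prop) (fun z _ => hX1 z) (fun z _ => hX2 z) ?_
    · have e1 (t : ℝ) : ((y.1 + 1, t) : ℝ × ℝ) = (y.1, t) + (1, 0) := by simp
      have e2 (s : ℝ) : ((s, y.2 + 1) : ℝ × ℝ) = (s, y.2) + (0, 1) := by simp
      simp only [e1, e2, hper1, hper2, hp11, hp22, sub_self, zero_add] at hdiv
      rw [← hdiv]
      congr! 4 with s t
      simp [hg, pd1, pd2]
      ring
    · refine ContinuousOn.integrableOn_compact (isCompact_uIcc.prod isCompact_uIcc) ?_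
      refine (hgc.congr fun z => ?_).continuousOn
      simp [hg, pd1, pd2]
      ring
  have hz (y : ℝ × ℝ) : max (v y) 0 * (pd1 v y ^ 2 + pd2 v y ^ 2) = 0 := by
    linarith [hle y, hnn y, hnn' y, hg0 y]
  by_contra! hx
  have hconst := is_const_of_fderiv_eq_zero (𝕜 := ℝ) (f := fun z => max (v z) 0 ^ 2)
    (fun y => (hw y).differentiableAt) fun y => by
      rw [(hw y).fderiv]
      rcases mul_eq_zero.1 (hz y) with h | h
      · simp [h]
      · have h1 : pd1 v y = 0 := by nlinarith [sq_nonneg (pd1 v y), sq_nonneg (pd2 v y)]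
        have h2 : pd2 v y = 0 := by nlinarith [sq_nonneg (pd1 v y), sq_nonneg (pd2 v y)]
        rw [fderiv_eq_zero_of_pd h1 h2, smul_zero]
  obtain ⟨y, hy⟩ := hp0
  have hvy : 0 < v y := by
    by_contra! h
    have := hconst y x
    simp only [max_eq_right h, max_eq_left hx.le] at this
    nlinarith
  have : 0 < max (v y) 0 ^ 2 * (p y * v y) := by
    have := (hp y).lt_of_ne' hy
    rw [max_eq_left hvy.le]; positivity
  linarith [hle y, hnn' y, hg0 y]

end MaximumPrinciple

section CovariantCalculus

open ComplexConjugate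

lemma contDiff_D1 {a : ℝ × ℝ → ℝ} {φ : ℝ × ℝ → ℂ} (ha : ContDiff ℝ (⊤ : ℕ∞) a)
    (hφ : ContDiff ℝ (⊤ : ℕ∞) φ) : ContDiff ℝ (⊤ : ℕ∞) (D1 a φ) :=
  (contDiff_pd1 hφ).add ((contDiff_const.mul (ofRealCLM.contDiff.comp ha)).mul hφ)

lemma contDiff_D2 {a : ℝ × ℝ → ℝ} {φ : ℝ × ℝ → ℂ} (ha : ContDiff ℝ (⊤ : ℕ∞) a)
    (hφ : ContDiff ℝ (⊤ : ℕ∞) φ) : ContDiff ℝ (⊤ : ℕ∞) (D2 a φ) :=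
  (contDiff_pd2 hφ).add ((contDiff_const.mul (ofRealCLM.contDiff.comp ha)).mul hφ)

lemma fderiv_clm_conj_mul (L : ℂ →L[ℝ] ℝ) {f g : ℝ × ℝ → ℂ} {x : ℝ × ℝ}
    (hf : DifferentiableAt ℝ f x) (hg : DifferentiableAt ℝ g x) (u : ℝ × ℝ) :
    fderiv ℝ (fun y => L (conj (f y) * g y)) x u =
      L (conj (fderiv ℝ f x u) * g x + conj (f x) * fderiv ℝ g x u) := by
  have hc : HasFDerivAt (fun y => conj (f y))
      ((conjCLE : ℂ →L[ℝ] ℂ).comp (fderiv ℝ f x)) x :=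
    (conjCLE : ℂ →L[ℝ] ℂ).hasFDerivAt.comp x hf.hasFDerivAt
  have := L.hasFDerivAt.comp x (hc.mul hg.hasFDerivAt)
  refine (congrArg (fun T : ℝ × ℝ →L[ℝ] ℝ => T u) this.fderiv).trans ?_
  simp
  ring_nf

lemma pd1_clm_conj_mul (L : ℂ →L[ℝ] ℝ) (a : ℝ × ℝ → ℝ) {f g : ℝ × ℝ → ℂ}
    (hf : ContDiff ℝ (⊤ : ℕ∞) f) (hg : ContDiff ℝ (⊤ : ℕ∞) g) (x : ℝ × ℝ) :
    pd1 (fun y => L (conj (f y) * g y)) x =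
      L (conj (D1 a f x) * g x + conj (f x) * D1 a g x) := by
  refine (fderiv_clm_conj_mul L (hf.differentiableAt_of_top x) (hg.differentiableAt_of_top x)
    _).trans (congrArg L ?_)
  simp only [D1, pd1, map_add, map_mul, conj_I, conj_ofReal]
  ring

lemma pd2_clm_conj_mul (L : ℂ →L[ℝ] ℝ) (a : ℝ × ℝ → ℝ) {f g : ℝ × ℝ → ℂ}
    (hf : ContDiff ℝ (⊤ : ℕ∞) f) (hg : ContDiff ℝ (⊤ : ℕ∞) g) (x : ℝ × ℝ) :
    pd2 (fun y => L (conj (f y) * g y)) x =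
      L (conj (D2 a f x) * g x + conj (f x) * D2 a g x) := by
  refine (fderiv_clm_conj_mul L (hf.differentiableAt_of_top x) (hg.differentiableAt_of_top x)
    _).trans (congrArg L ?_)
  simp only [D2, pd2, map_add, map_mul, conj_I, conj_ofReal]
  ring

lemma fderiv_add_I_mul {a : ℝ × ℝ → ℝ} {f φ : ℝ × ℝ → ℂ} {x : ℝ × ℝ}
    (hf : DifferentiableAt ℝ f x) (ha : DifferentiableAt ℝ a x) (hφ : DifferentiableAt ℝ φ x)
    (u : ℝ × ℝ) :
    fderiv ℝ (fun y => f y + I * (a y : ℂ) * φ y) x u =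
      fderiv ℝ f x u + I * (fderiv ℝ a x u : ℂ) * φ x + I * (a x : ℂ) * fderiv ℝ φ x u := by
  have hc : HasFDerivAt (fun y => (a y : ℂ)) (ofRealCLM.comp (fderiv ℝ a x)) x :=
    ofRealCLM.hasFDerivAt.comp x ha.hasFDerivAt
  have := hf.hasFDerivAt.add ((hc.const_mul I).mul hφ.hasFDerivAt)
  refine (congrArg (fun T : ℝ × ℝ →L[ℝ] ℂ => T u) this.fderiv).trans ?_
  simp
  ring

/-- The commutator of the covariant derivatives is the curvature: `[D₁, D₂]φ = i F(a) φ`. -/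
lemma D1_D2_sub_D2_D1 {a1 a2 : ℝ × ℝ → ℝ} {φ : ℝ × ℝ → ℂ} (ha1 : ContDiff ℝ (⊤ : ℕ∞) a1)
    (ha2 : ContDiff ℝ (⊤ : ℕ∞) a2) (hφ : ContDiff ℝ (⊤ : ℕ∞) φ) (x : ℝ × ℝ) :
    D1 a1 (D2 a2 φ) x - D2 a2 (D1 a1 φ) x = I * (curv a1 a2 x : ℂ) * φ x := by
  have h12 : pd1 (D2 a2 φ) x =
      pd1 (pd2 φ) x + I * ((pd1 a2 x : ℝ) : ℂ) * φ x + I * (a2 x : ℂ) * pd1 φ x :=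
    fderiv_add_I_mul ((contDiff_pd2 hφ).differentiableAt_of_top x)
      (ha2.differentiableAt_of_top x) (hφ.differentiableAt_of_top x) _
  have h21 : pd2 (D1 a1 φ) x =
      pd2 (pd1 φ) x + I * ((pd2 a1 x : ℝ) : ℂ) * φ x + I * (a1 x : ℂ) * pd2 φ x :=
    fderiv_add_I_mul ((contDiff_pd1 hφ).differentiableAt_of_top x)
      (ha1.differentiableAt_of_top x) (hφ.differentiableAt_of_top x) _
  change pd1 (D2 a2 φ) x + I * (a1 x : ℂ) * D2 a2 φ x
    - (pd2 (D1 a1 φ) x + I * (a2 x : ℂ) * D1 a1 φ x) = _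
  rw [h12, h21, pd1_pd2_comm hφ]
  simp only [D1, D2, curv, ofReal_sub]
  ring

lemma norm_sq_eq_re_conj_mul (z : ℂ) : ‖z‖ ^ 2 = reCLM (conj z * z) := by
  rw [Complex.sq_norm, ← normSq_eq_conj_mul_self]
  simp

lemma pd1_norm_sq (a : ℝ × ℝ → ℝ) {φ : ℝ × ℝ → ℂ} (hφ : ContDiff ℝ (⊤ : ℕ∞) φ) :
    pd1 (fun y => ‖φ y‖ ^ 2) = fun y => ((2 : ℝ) • reCLM) (conj (φ y) * D1 a φ y) := by
  funext x
  simp only [norm_sq_eq_re_conj_mul]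
  rw [pd1_clm_conj_mul reCLM a hφ hφ]
  simp
  ring

lemma pd2_norm_sq (a : ℝ × ℝ → ℝ) {φ : ℝ × ℝ → ℂ} (hφ : ContDiff ℝ (⊤ : ℕ∞) φ) :
    pd2 (fun y => ‖φ y‖ ^ 2) = fun y => ((2 : ℝ) • reCLM) (conj (φ y) * D2 a φ y) := by
  funext x
  simp only [norm_sq_eq_re_conj_mul]
  rw [pd2_clm_conj_mul reCLM a hφ hφ]
  simp
  ring

lemma fderiv_affine_comb {f g : ℝ × ℝ → ℝ} (hf : ContDiff ℝ (⊤ : ℕ∞) f)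
    (hg : ContDiff ℝ (⊤ : ℕ∞) g) (c s k : ℝ) (x u : ℝ × ℝ) :
    fderiv ℝ (fun y => c * f y + s * g y + k) x u =
      c * fderiv ℝ f x u + s * fderiv ℝ g x u := by
  have := (((hf.differentiableAt_of_top x).hasFDerivAt.const_mul c).add
    ((hg.differentiableAt_of_top x).hasFDerivAt.const_mul s)).add_const k
  refine (congrArg (fun T : ℝ × ℝ →L[ℝ] ℝ => T u) this.fderiv).trans ?_
  simp

lemma laplacian_affine_comb {f g : ℝ × ℝ → ℝ} (hf : ContDiff ℝ (⊤ : ℕ∞) f)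
    (hg : ContDiff ℝ (⊤ : ℕ∞) g) (c s k : ℝ) (x : ℝ × ℝ) :
    pd1 (pd1 fun y => c * f y + s * g y + k) x + pd2 (pd2 fun y => c * f y + s * g y + k) x =
      c * (pd1 (pd1 f) x + pd2 (pd2 f) x) + s * (pd1 (pd1 g) x + pd2 (pd2 g) x) := by
  have h1 : (pd1 fun y => c * f y + s * g y + k) = fun y => c * pd1 f y + s * pd1 g y + 0 := by
    funext y; rw [add_zero]; exact fderiv_affine_comb hf hg c s k y _
  have h2 : (pd2 fun y => c * f y + s * g y + k) = fun y => c * pd2 f y + s * pd2 g y + 0 := by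
    funext y; rw [add_zero]; exact fderiv_affine_comb hf hg c s k y _
  have e1 := fderiv_affine_comb (contDiff_pd1 hf) (contDiff_pd1 hg) c s 0 x (1, 0)
  have e2 := fderiv_affine_comb (contDiff_pd2 hf) (contDiff_pd2 hg) c s 0 x (0, 1)
  rw [h1, h2]
  refine (congrArg₂ (· + ·) e1 e2).trans ?_
  simp only [pd1, pd2]
  ring

end CovariantCalculus

section GinzburgLandau

open ComplexConjugate

variable {d : ℤ} (P : FieldPair d)

lemma FieldPair.contDiff_curv : ContDiff ℝ (⊤ : ℕ∞) (curv P.a1 P.a2) :=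
  (contDiff_pd1 P.smooth_a2).sub (contDiff_pd2 P.smooth_a1)

lemma FieldPair.contDiff_norm_sq : ContDiff ℝ (⊤ : ℕ∞) (fun y => ‖P.φ y‖ ^ 2) :=
  P.smooth_φ.norm_sq ℝ

lemma FieldPair.norm_φ_add_left (x : ℝ × ℝ) : ‖P.φ (x + (1, 0))‖ = ‖P.φ x‖ := by
  rw [← P.per1_φ x]
  simp [Prod.add_def]

lemma FieldPair.norm_φ_add_right (x : ℝ × ℝ) : ‖P.φ (x + (0, 1))‖ = ‖P.φ x‖ := by
  have h : x + (0, 1) = (x.1, x.2 + 1) := by simp [Prod.add_def]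
  have e : (2 * Real.pi * I * (d : ℂ) * (x.1 : ℂ)) = ((2 * Real.pi * d * x.1 : ℝ) : ℂ) * I := by
    push_cast; ring
  rw [h, P.per2_φ, norm_mul, e, norm_exp_ofReal_mul_I, one_mul]

lemma FieldPair.curv_add_left (x : ℝ × ℝ) :
    curv P.a1 P.a2 (x + (1, 0)) = curv P.a1 P.a2 x := by
  have h (y : ℝ × ℝ) : y + (1, 0) = (y.1 + 1, y.2) := by simp [Prod.add_def]
  simp only [curv, pd1, pd2, ← fderiv_comp_add]
  simp only [h, P.per1_a1, P.per1_a2]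

lemma FieldPair.curv_add_right (x : ℝ × ℝ) :
    curv P.a1 P.a2 (x + (0, 1)) = curv P.a1 P.a2 x := by
  have h (y : ℝ × ℝ) : y + (0, 1) = (y.1, y.2 + 1) := by simp [Prod.add_def]
  simp only [curv, pd1, pd2, ← fderiv_comp_add]
  simp only [h, P.per2_a1, P.per2_a2, fderiv_sub_const]

variable {P} {α β : ℝ} {F₀ : ℝ × ℝ → ℝ}

lemma IsGLSolution.laplacian_norm_sq (hP : IsGLSolution α β F₀ P) (x : ℝ × ℝ) :
    pd1 (pd1 fun y => ‖P.φ y‖ ^ 2) x + pd2 (pd2 fun y => ‖P.φ y‖ ^ 2) x =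
      2 * (‖D1 P.a1 P.φ x‖ ^ 2 + ‖D2 P.a2 P.φ x‖ ^ 2
        + ‖P.φ x‖ ^ 2 * (β * ‖P.φ x‖ ^ 2 - α)) := by
  rw [pd1_norm_sq P.a1 P.smooth_φ, pd2_norm_sq P.a2 P.smooth_φ,
    pd1_clm_conj_mul _ P.a1 P.smooth_φ (contDiff_D1 P.smooth_a1 P.smooth_φ),
    pd2_clm_conj_mul _ P.a2 P.smooth_φ (contDiff_D2 P.smooth_a2 P.smooth_φ)]
  have h := congrArg (fun z => (conj (P.φ x) * z).re) (hP.2.2 x)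
  have hq : (‖P.φ x‖ : ℂ) ^ 2 = ((‖P.φ x‖ ^ 2 : ℝ) : ℂ) := by push_cast; rfl
  rw [hq] at h
  generalize hN : ‖P.φ x‖ ^ 2 = N at h ⊢
  rw [Complex.sq_norm, normSq_apply] at hN
  simp [Complex.sq_norm, normSq_apply] at h ⊢
  linear_combination -2 * h - 2 * (α - β * N) * hN

lemma IsGLSolution.laplacian_curv (hP : IsGLSolution α β F₀ P) {c : ℝ} (hc : ∀ x, F₀ x = c)
    (x : ℝ × ℝ) :
    pd1 (pd1 (curv P.a1 P.a2)) x + pd2 (pd2 (curv P.a1 P.a2)) x =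
      ‖P.φ x‖ ^ 2 * curv P.a1 P.a2 x
        + 2 * (conj (D1 P.a1 P.φ x) * D2 P.a2 P.φ x).im := by
  have h1 : pd1 (curv P.a1 P.a2) = fun y => imCLM (conj (P.φ y) * D2 P.a2 P.φ y) := by
    funext y
    have := hP.2.1 y
    simp only [hc, pd1, fderiv_sub_const] at this
    simp only [pd1, imCLM_apply]
    linarith
  have h2 : pd2 (curv P.a1 P.a2) = fun y => (-imCLM) (conj (P.φ y) * D1 P.a1 P.φ y) := by
    funext y
    have := hP.1 y
    simp only [hc, pd2, fderiv_sub_const] at this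
    simp only [pd2, _root_.neg_apply, imCLM_apply]
    linarith
  rw [h1, h2, pd1_clm_conj_mul _ P.a1 P.smooth_φ (contDiff_D2 P.smooth_a2 P.smooth_φ),
    pd2_clm_conj_mul _ P.a2 P.smooth_φ (contDiff_D1 P.smooth_a1 P.smooth_φ)]
  have h := congrArg (fun z => (conj (P.φ x) * z).im)
    (D1_D2_sub_D2_D1 P.smooth_a1 P.smooth_a2 P.smooth_φ x)
  simp [Complex.sq_norm, normSq_apply] at h ⊢
  linear_combination h

lemma IsGLSolution.norm_sq_le (hP : IsGLSolution α β F₀ P) (hβ : 0 < β)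
    (hirr : ∃ x, P.φ x ≠ 0) (x : ℝ × ℝ) : ‖P.φ x‖ ^ 2 ≤ α / β := by
  have hq := P.contDiff_norm_sq
  have key := nonpos_of_mul_le_laplacian
    (v := fun y => 1 * ‖P.φ y‖ ^ 2 + 0 * ‖P.φ y‖ ^ 2 + -(α / β))
    (p := fun y => 2 * β * ‖P.φ y‖ ^ 2)
    (((contDiff_const.mul hq).add (contDiff_const.mul hq)).add contDiff_const)
    (fun y => by simp only [P.norm_φ_add_left]) (fun y => by simp only [P.norm_φ_add_right])
    (fun y => by positivity)
    (hirr.imp fun y hy => by have := norm_pos_iff.2 hy; positivity)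
    (fun y => by
      rw [laplacian_affine_comb hq hq, hP.laplacian_norm_sq]
      have : β * (α / β) = α := by field_simp
      nlinarith [sq_nonneg ‖D1 P.a1 P.φ y‖, sq_nonneg ‖D2 P.a2 P.φ y‖]) x
  linarith

lemma abs_two_mul_im_conj_mul_le (z w : ℂ) :
    |2 * (conj z * w).im| ≤ ‖z‖ ^ 2 + ‖w‖ ^ 2 := by
  simp only [mul_im, conj_re, conj_im, Complex.sq_norm, normSq_apply, abs_le]
  constructor <;>
    nlinarith [sq_nonneg (z.re - w.im), sq_nonneg (z.im + w.re), sq_nonneg (z.re + w.im),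
      sq_nonneg (z.im - w.re)]

lemma IsGLSolution.mul_curv_add_le (hP : IsGLSolution α β F₀ P) (hα : 0 < α) (hβ : 0 < β)
    (hirr : ∃ x, P.φ x ≠ 0) {c : ℝ} (hc : ∀ x, F₀ x = c) {s : ℝ} (hs : |s| = 1) (x : ℝ × ℝ) :
    s * curv P.a1 P.a2 x ≤ max α (α / (2 * β)) - ‖P.φ x‖ ^ 2 / 2 := by
  have hq := P.contDiff_norm_sq
  have hh := P.contDiff_curv
  have key := nonpos_of_mul_le_laplacian
    (v := fun y => 1 / 2 * ‖P.φ y‖ ^ 2 + s * curv P.a1 P.a2 y + -max α (α / (2 * β)))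
    (p := fun y => ‖P.φ y‖ ^ 2)
    (((contDiff_const.mul hq).add (contDiff_const.mul hh)).add contDiff_const)
    (fun y => by simp only [P.norm_φ_add_left, P.curv_add_left])
    (fun y => by simp only [P.norm_φ_add_right, P.curv_add_right])
    (fun y => by positivity)
    (hirr.imp fun y hy => by have := norm_pos_iff.2 hy; positivity)
    (fun y => by
      rw [laplacian_affine_comb hq hh, hP.laplacian_norm_sq, hP.laplacian_curv hc]
      have hle := hP.norm_sq_le hβ hirr y
      have hM : α + (1 / 2 - β) * ‖P.φ y‖ ^ 2 ≤ max α (α / (2 * β)) := by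
        rcases le_total (1 / 2) β with h | h
        · exact le_max_of_le_left (by nlinarith [sq_nonneg ‖P.φ y‖])
        · refine le_max_of_le_right ?_
          have := mul_le_mul_of_nonneg_left hle (sub_nonneg.2 h)
          have e : α + (1 / 2 - β) * (α / β) = α / (2 * β) := by field_simp; ring
          linarith
      have hcross : -(‖D1 P.a1 P.φ y‖ ^ 2 + ‖D2 P.a2 P.φ y‖ ^ 2) ≤
          s * (2 * (conj (D1 P.a1 P.φ y) * D2 P.a2 P.φ y).im) := by
        refine neg_le_of_abs_le ?_
        rw [abs_mul, hs, one_mul]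
        exact abs_two_mul_im_conj_mul_le _ _
      nlinarith [mul_le_mul_of_nonneg_left hM (sq_nonneg ‖P.φ y‖)]) x
  linarith

end GinzburgLandau

/-- for constant `F₀` and an irreducible degree-`d` GL solution,
`|F(a)| ≤ max{α, α/(2β)} − |φ|²/2` pointwise. -/
theorem statement8 (α β : ℝ) (hα : 0 < α) (hβ : 0 < β) (d : ℤ) (F₀ : ℝ × ℝ → ℝ)
    (hF₀ : ExternalField d F₀) (hconst : ∃ c : ℝ, ∀ x : ℝ × ℝ, F₀ x = c)
    (P : FieldPair d) (hP : IsGLSolution α β F₀ P) (hirr : ∃ x : ℝ × ℝ, P.φ x ≠ 0) :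
    ∀ x : ℝ × ℝ, |curv P.a1 P.a2 x| ≤ max α (α / (2 * β)) - ‖P.φ x‖ ^ 2 / 2 := by
  obtain ⟨c, hc⟩ := hconst
  intro x
  refine abs_le'.2 ⟨?_, ?_⟩
  · simpa using hP.mul_curv_add_le hα hβ hirr hc (s := 1) (by simp) x
  · simpa using hP.mul_curv_add_le hα hβ hirr hc (s := -1) (by simp) x
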